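/- Let k be an algebraically closed field of characteristic different from 2 and let f ∈ k[x,y,z] be homogeneous of degree 4 such that the plane curve V(f) ⊂ ℙ²_k is smooth (the gradient of f is nonzero at every nonzero zero of f). Then there are exactly 28 lines L ⊂ ℙ²_k such that the restriction of f to L is a nonzero scalar multiple of the square of a quadratic form on L (i.e. exactly 28 bitangent lines of V(f)). -/

import Mathlib

open MvPolynomial

/-- The line `V(ℓ)` in `ℙ²_k` is a bitangent of the quartic `V(f)`: the restriction of
`f` to the line is a nonzero scalar multiple of the square of a quadratic form that is
nonzero on the line. -/
def IsBitangentLine {k : Type*} [Field k] (f : MvPolynomial (Fin 3) k)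
    (ℓ : Fin 3 → k) : Prop :=
  ℓ ≠ 0 ∧ ∃ (q : MvPolynomial (Fin 3) k) (c : k), c ≠ 0 ∧ q.IsHomogeneous 2 ∧
    (∃ p : Fin 3 → k, (∑ i, ℓ i * p i) = 0 ∧ eval p q ≠ 0) ∧
    (∀ p : Fin 3 → k, (∑ i, ℓ i * p i) = 0 → eval p f = c * (eval p q) ^ 2)

open scoped Matrix

namespace PlaneQuartic

section Polar

variable {k A B : Type*} [Field k] [CommRing A] [Algebra k A] [CommRing B] [Algebra k B]

/-- The polynomial `h (x + T y)` in one variable `T`. -/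
noncomputable def restrictLine (h : MvPolynomial (Fin 3) k) (x y : Fin 3 → A) : Polynomial A :=
  aeval (fun j => Polynomial.C (x j) + Polynomial.X * Polynomial.C (y j)) h

/-- The coefficient of `T ^ i` in `h (x + T y)`. -/
noncomputable def polar (h : MvPolynomial (Fin 3) k) (x y : Fin 3 → A) (i : ℕ) : A :=
  (restrictLine h x y).coeff i

lemma polar_map (φ : A →ₐ[k] B) (h : MvPolynomial (Fin 3) k) (x y : Fin 3 → A) (i : ℕ) :
    polar h (fun j => φ (x j)) (fun j => φ (y j)) i = φ (polar h x y i) := by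
  have : restrictLine h (fun j => φ (x j)) (fun j => φ (y j))
      = Polynomial.mapAlgHom φ (restrictLine h x y) := by
    unfold restrictLine
    rw [← AlgHom.comp_apply, comp_aeval]
    congr 2
    funext j
    simp
  simp [polar, this]

lemma polar_mul_X_zero (h : MvPolynomial (Fin 3) k) (x y : Fin 3 → A) (j : Fin 3) :
    polar (h * X j) x y 0 = polar h x y 0 * x j := by
  simp [polar, restrictLine, mul_add, Polynomial.mul_coeff_zero]

lemma polar_mul_X_succ (h : MvPolynomial (Fin 3) k) (x y : Fin 3 → A) (j : Fin 3) (i : ℕ) :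
    polar (h * X j) x y (i + 1) = polar h x y (i + 1) * x j + polar h x y i * y j := by
  simp [polar, restrictLine, mul_add, ← mul_assoc, Polynomial.coeff_mul_X]

lemma monomial_expand (φ : A →ₐ[k] B) (x y : Fin 3 → A) (d : ℕ) : ∀ (m : Fin 3 →₀ ℕ) (c : k),
    m.degree = d → (∀ i, d < i → polar (monomial m c) x y i = 0) ∧ ∀ s t : B,
    aeval (fun j => s * φ (x j) + t * φ (y j)) (monomial m c)
      = ∑ i ∈ Finset.range (d + 1), s ^ (d - i) * t ^ i * φ (polar (monomial m c) x y i) := by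
  induction d with
  | zero =>
    intro m c hm
    have hm0 : m = 0 := (Finsupp.degree_eq_zero_iff m).1 hm
    subst hm0
    constructor
    · intro i hi
      simp [polar, restrictLine, Polynomial.algebraMap_apply, Polynomial.coeff_C, hi.ne']
    · intro s t
      simp [polar, restrictLine, Polynomial.algebraMap_apply]
  | succ d ih =>
    intro m c hm
    obtain ⟨j, hj⟩ : ∃ j, m j ≠ 0 := by
      by_contra! hcon
      have : m = 0 := Finsupp.ext hcon
      simp [this] at hm
    obtain ⟨m', rfl⟩ : ∃ m', m = m' + Finsupp.single j 1 := by
      refine ⟨m - Finsupp.single j 1, (tsub_add_cancel_of_le ?_).symm⟩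
      rw [Finsupp.single_le_iff]
      omega
    have hm' : m'.degree = d := by
      simpa using hm
    have hmon : monomial (m' + Finsupp.single j 1) c = monomial m' c * X j := by
      rw [X, monomial_mul, mul_one]
    obtain ⟨h0, h1⟩ := ih m' c hm'
    rw [hmon]
    constructor
    · intro i hi
      obtain ⟨i, rfl⟩ : ∃ i', i = i' + 1 := ⟨i - 1, by omega⟩
      rw [polar_mul_X_succ, h0 _ (by omega), h0 _ (by omega)]
      simp
    · intro s t
      rw [map_mul, h1, aeval_X, Finset.sum_range_succ' (n := d + 1), polar_mul_X_zero]
      simp only [polar_mul_X_succ, map_add, map_mul, mul_add, Finset.sum_add_distrib]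
      have e1 : ∑ i ∈ Finset.range (d + 1), s ^ (d + 1 - (i + 1)) * t ^ (i + 1) *
          (φ (polar (monomial m' c) x y (i + 1)) * φ (x j)) + s ^ (d + 1 - 0) * t ^ 0 *
            (φ (polar (monomial m' c) x y 0) * φ (x j))
          = (∑ i ∈ Finset.range (d + 1), s ^ (d - i) * t ^ i *
            φ (polar (monomial m' c) x y i)) * (s * φ (x j)) := by
        rw [← Finset.sum_range_succ' (fun i => s ^ (d + 1 - i) * t ^ i *
          (φ (polar (monomial m' c) x y i) * φ (x j))), Finset.sum_range_succ,
          h0 (d + 1) (by omega), Finset.sum_mul]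
        simp only [map_zero, zero_mul, mul_zero, add_zero]
        refine Finset.sum_congr rfl fun i hi => ?_
        rw [Finset.mem_range] at hi
        rw [show d + 1 - i = (d - i) + 1 by omega]
        ring
      have e2 : ∑ i ∈ Finset.range (d + 1), s ^ (d + 1 - (i + 1)) * t ^ (i + 1) *
          (φ (polar (monomial m' c) x y i) * φ (y j))
          = (∑ i ∈ Finset.range (d + 1), s ^ (d - i) * t ^ i *
            φ (polar (monomial m' c) x y i)) * (t * φ (y j)) := by
        rw [Finset.sum_mul]
        refine Finset.sum_congr rfl fun i hi => ?_
        rw [show d + 1 - (i + 1) = d - i by omega]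
        ring
      rw [← e1, ← e2]
      ring

/-- Binary expansion of a ternary form on the span of two vectors. -/
lemma aeval_expand (φ : A →ₐ[k] B) {d : ℕ} {h : MvPolynomial (Fin 3) k} (hh : h.IsHomogeneous d)
    (x y : Fin 3 → A) (s t : B) :
    aeval (fun j => s * φ (x j) + t * φ (y j)) h
      = ∑ i ∈ Finset.range (d + 1), s ^ (d - i) * t ^ i * φ (polar h x y i) := by
  have hpol : ∀ i, polar h x y i
      = ∑ m ∈ h.support, polar (monomial m (h.coeff m)) x y i := by
    intro i
    simp only [polar, restrictLine]
    conv_lhs => rw [h.as_sum, map_sum]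
    rw [Polynomial.finsetSum_coeff]
  conv_lhs => rw [h.as_sum, map_sum]
  simp only [hpol, map_sum, Finset.mul_sum]
  rw [Finset.sum_comm]
  refine Finset.sum_congr rfl fun m hm => ?_
  exact (monomial_expand φ x y d m _ (by
    by_contra hne
    exact (mem_support_iff.1 hm) (hh.coeff_eq_zero hne))).2 s t

/-- The same expansion over one and the same ring. -/
lemma aeval_expand_self {d : ℕ} {h : MvPolynomial (Fin 3) k} (hh : h.IsHomogeneous d)
    (x y : Fin 3 → A) (s t : A) :
    aeval (fun j => s * x j + t * y j) h
      = ∑ i ∈ Finset.range (d + 1), s ^ (d - i) * t ^ i * polar h x y i := by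
  simpa using aeval_expand (AlgHom.id k A) hh x y s t

lemma polar_zero (h : MvPolynomial (Fin 3) k) (x y : Fin 3 → A) : polar h x y 0 = aeval x h := by
  induction h using MvPolynomial.induction_on with
  | C a => simp [polar, restrictLine, Polynomial.algebraMap_apply]
  | add p q hp hq => simp_all [polar, restrictLine]
  | mul_X p j hp => rw [polar_mul_X_zero, hp]; simp

lemma polar_one (h : MvPolynomial (Fin 3) k) (x y : Fin 3 → A) :
    polar h x y 1 = ∑ j, aeval x (pderiv j h) * y j := by
  induction h using MvPolynomial.induction_on with
  | C a => simp [polar, restrictLine, Polynomial.algebraMap_apply]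
  | add p q hp hq =>
    have : polar (p + q) x y 1 = polar p x y 1 + polar q x y 1 := by simp [polar, restrictLine]
    rw [this, hp, hq]
    simp [add_mul, Finset.sum_add_distrib]
  | mul_X p j hp =>
    rw [polar_mul_X_succ, hp, polar_zero]
    fin_cases j <;> simp [Fin.sum_univ_three, pderiv_X, Pi.single_apply] <;> ring

lemma restrictLine_eq_sum {d : ℕ} {h : MvPolynomial (Fin 3) k} (hh : h.IsHomogeneous d)
    (x y : Fin 3 → A) :
    restrictLine h x y = ∑ i ∈ Finset.range (d + 1),
      Polynomial.X ^ i * Polynomial.C (polar h x y i) := by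
  have := aeval_expand (Polynomial.CAlgHom (R := k) (A := A)) hh x y 1 Polynomial.X
  rw [restrictLine]
  simpa only [Polynomial.CAlgHom_apply, one_mul, one_pow] using this

lemma polar_homog {d : ℕ} {h : MvPolynomial (Fin 3) k} (hh : h.IsHomogeneous d)
    (x y : Fin 3 → A) (s t : A) (i : ℕ) (hi : i ≤ d) :
    polar h (fun j => s * x j) (fun j => t * y j) i = s ^ (d - i) * t ^ i * polar h x y i := by
  have h1 := aeval_expand (Polynomial.CAlgHom (R := k) (A := A)) hh x y
    (Polynomial.C s) (Polynomial.X * Polynomial.C t)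
  have h2 : (fun j => Polynomial.C s * Polynomial.CAlgHom (R := k) (x j)
      + Polynomial.X * Polynomial.C t * Polynomial.CAlgHom (R := k) (y j))
      = fun j => Polynomial.C (s * x j) + Polynomial.X * Polynomial.C (t * y j) := by
    funext j
    simp only [Polynomial.CAlgHom_apply, Polynomial.C_mul]
    ring
  have h3 : ∀ i, (Polynomial.C s) ^ (d - i) * (Polynomial.X * Polynomial.C t) ^ i *
      Polynomial.CAlgHom (R := k) (polar h x y i)
      = Polynomial.C (s ^ (d - i) * t ^ i * polar h x y i) * Polynomial.X ^ i := by
    intro i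
    simp only [Polynomial.CAlgHom_apply, Polynomial.C_mul, Polynomial.C_pow]
    ring
  rw [h2] at h1
  simp only [h3] at h1
  rw [polar, restrictLine, h1, Polynomial.finsetSum_coeff]
  simp only [Polynomial.coeff_C_mul, Polynomial.coeff_X_pow]
  simp [hi]

/-- The gradient of a form, evaluated at `x`. -/
noncomputable def grad (h : MvPolynomial (Fin 3) k) (x : Fin 3 → A) : Fin 3 → A :=
  fun j => aeval x (pderiv j h)

/-- The linear form with coefficient vector `u`. -/
noncomputable def lin (u : Fin 3 → k) : MvPolynomial (Fin 3) k := ∑ j, C (u j) * X j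

/-- The discriminant of the residual quadratic form `h (x + T y) / T ^ 2`. -/
noncomputable def residualDisc (h : MvPolynomial (Fin 3) k) (x y : Fin 3 → A) : A :=
  polar h x y 3 ^ 2 - 4 * polar h x y 2 * polar h x y 4

/-- The residual discriminant at `x` along the tangent direction cut out by the vector `v`. -/
noncomputable def tangentDisc (h : MvPolynomial (Fin 3) k) (v x : Fin 3 → A) : A :=
  residualDisc h x (grad h x ⨯₃ v)

lemma aeval_lin (u : Fin 3 → k) (x : Fin 3 → A) :
    aeval x (lin u) = ∑ j, algebraMap k A (u j) * x j := by
  simp [lin]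

lemma residualDisc_homog {h : MvPolynomial (Fin 3) k} (hh : h.IsHomogeneous 4)
    (x y : Fin 3 → A) (s t : A) :
    residualDisc h (fun j => s * x j) (fun j => t * y j) = s ^ 2 * t ^ 6 * residualDisc h x y := by
  simp only [residualDisc]
  rw [polar_homog hh x y s t 3 (by norm_num), polar_homog hh x y s t 2 (by norm_num),
    polar_homog hh x y s t 4 (by norm_num)]
  ring

lemma residualDisc_add {h : MvPolynomial (Fin 3) k} (hh : h.IsHomogeneous 4)
    (x y : Fin 3 → A) (c : A) (h0 : aeval x h = 0) (h1 : ∑ j, grad h x j * y j = 0) :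
    residualDisc h x (fun j => y j + c * x j) = residualDisc h x y := by
  have h1' := aeval_expand (Polynomial.CAlgHom (R := k) (A := A)) hh x y
    (1 + Polynomial.C c * Polynomial.X) Polynomial.X
  have h2 : (fun j => (1 + Polynomial.C c * Polynomial.X) * Polynomial.CAlgHom (R := k) (x j)
      + Polynomial.X * Polynomial.CAlgHom (R := k) (y j))
      = fun j => Polynomial.C (x j) + Polynomial.X * Polynomial.C (y j + c * x j) := by
    funext j
    simp only [Polynomial.CAlgHom_apply, Polynomial.C_mul, Polynomial.C_add]
    ring
  have p0 : polar h x y 0 = 0 := by rw [polar_zero, h0]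
  have p1 : polar h x y 1 = 0 := by rw [polar_one]; exact h1
  rw [h2] at h1'
  have key : restrictLine h x (fun j => y j + c * x j)
      = Polynomial.C (polar h x y 2) * Polynomial.X ^ 2
        + Polynomial.C (2 * c * polar h x y 2 + polar h x y 3) * Polynomial.X ^ 3
        + Polynomial.C (c ^ 2 * polar h x y 2 + c * polar h x y 3 + polar h x y 4)
          * Polynomial.X ^ 4 := by
    rw [restrictLine, h1']
    simp only [Finset.sum_range_succ, Finset.sum_range_zero, p0, p1, map_zero,
      Polynomial.CAlgHom_apply, Polynomial.C_mul, Polynomial.C_add, Polynomial.C_pow]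
    rw [show Polynomial.C (2 : A) = 2 from map_ofNat Polynomial.C 2]
    ring
  have q2 : polar h x (fun j => y j + c * x j) 2 = polar h x y 2 := by
    rw [polar, key]
    simp only [Polynomial.coeff_add, Polynomial.coeff_C_mul, Polynomial.coeff_X_pow]
    norm_num
  have q3 : polar h x (fun j => y j + c * x j) 3 = 2 * c * polar h x y 2 + polar h x y 3 := by
    rw [polar, key]
    simp only [Polynomial.coeff_add, Polynomial.coeff_C_mul, Polynomial.coeff_X_pow]
    norm_num
  have q4 : polar h x (fun j => y j + c * x j) 4
      = c ^ 2 * polar h x y 2 + c * polar h x y 3 + polar h x y 4 := by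
    rw [polar, key]
    simp only [Polynomial.coeff_add, Polynomial.coeff_C_mul, Polynomial.coeff_X_pow]
    norm_num
  rw [residualDisc, q2, q3, q4, residualDisc]
  ring

lemma euler {d : ℕ} {h : MvPolynomial (Fin 3) k} (hh : h.IsHomogeneous d) (x : Fin 3 → A) :
    ∑ j, x j * grad h x j = d * aeval x h := by
  have := congrArg (aeval x) hh.sum_X_mul_pderiv
  simpa [grad, map_sum] using this

lemma tangentDisc_mul {h : MvPolynomial (Fin 3) k} (hh : h.IsHomogeneous 4)
    (v w x : Fin 3 → A) (h0 : aeval x h = 0) :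
    (∑ j, x j * w j) ^ 6 * tangentDisc h v x = (∑ j, x j * v j) ^ 6 * tangentDisc h w x := by
  have hE : ∑ j, x j * grad h x j = 0 := by rw [euler hh, h0, mul_zero]
  set n := grad h x with hn
  have e1 := residualDisc_homog hh x (n ⨯₃ v) 1 (∑ j, x j * w j)
  have e2 := residualDisc_homog hh x (n ⨯₃ w) 1 (∑ j, x j * v j)
  simp only [one_mul, one_pow] at e1 e2
  rw [tangentDisc, tangentDisc, ← hn, ← e1, ← e2,
    ← residualDisc_add hh x (fun j => (∑ j, x j * v j) * (n ⨯₃ w) j)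
      (∑ j, n j * (v ⨯₃ w) j) h0]
  · congr 1
    funext j
    simp only [Fin.sum_univ_three] at hE ⊢
    fin_cases j <;> simp [cross_apply]
    · linear_combination -(v 1 * w 2 - v 2 * w 1) * hE
    · linear_combination -(v 2 * w 0 - v 0 * w 2) * hE
    · linear_combination -(v 0 * w 1 - v 1 * w 0) * hE
  · rw [← hn]
    simp only [Fin.sum_univ_three, cross_apply]
    simp
    ring

lemma polar_lin_mul_add {f q U : MvPolynomial (Fin 3) k} {l : Fin 3 → k} {c : k}
    (hf : f = lin l * U + C c * q ^ 2) (hq : q.IsHomogeneous 2) (hU : U.IsHomogeneous 3)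
    (x y : Fin 3 → A) :
    restrictLine f x y =
      (Polynomial.C (aeval x (lin l)) + Polynomial.C (aeval y (lin l)) * Polynomial.X)
      * (Polynomial.C (aeval x U) + Polynomial.C (polar U x y 1) * Polynomial.X
        + Polynomial.C (polar U x y 2) * Polynomial.X ^ 2
        + Polynomial.C (polar U x y 3) * Polynomial.X ^ 3)
      + Polynomial.C (algebraMap k A c) * (Polynomial.C (aeval x q)
        + Polynomial.C (polar q x y 1) * Polynomial.X
        + Polynomial.C (polar q x y 2) * Polynomial.X ^ 2) ^ 2 := by
  have e : restrictLine f x y = restrictLine (lin l) x y * restrictLine U x y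
      + Polynomial.C (algebraMap k A c) * restrictLine q x y ^ 2 := by
    simp [restrictLine, hf, Polynomial.algebraMap_apply]
  rw [e, restrictLine_eq_sum hq, restrictLine_eq_sum hU]
  have e3 : restrictLine (lin l) x y
      = Polynomial.C (aeval x (lin l)) + Polynomial.C (aeval y (lin l)) * Polynomial.X := by
    simp [restrictLine, lin, Fin.sum_univ_three, Polynomial.algebraMap_apply]
    ring
  rw [e3]
  simp only [Finset.sum_range_succ, Finset.sum_range_zero, polar_zero]
  ring

lemma grad_lin_mul_add {f q U : MvPolynomial (Fin 3) k} {l : Fin 3 → k} {c : k}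
    (hf : f = lin l * U + C c * q ^ 2) (x : Fin 3 → A) (hx : aeval x (lin l) = 0) (j : Fin 3) :
    grad f x j = aeval x U * algebraMap k A (l j)
      + 2 * algebraMap k A c * aeval x q * grad q x j := by
  have h1 : pderiv j (lin l) = C (l j) := by
    simp [lin, pderiv_X, Pi.single_apply]
  simp only [grad, hf, map_add, Derivation.leibniz, h1, smul_eq_mul, pderiv_C, map_mul,
    Derivation.leibniz_pow, hx, map_pow]
  simp
  ring

/-- Up to a scalar, the value of the cofactor `U` at the second contact point of the bitangent
whose first contact point is `x`. -/
noncomputable def contactFactor (f q U : MvPolynomial (Fin 3) k) (l : Fin 3 → k) (c : k)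
    (v x : Fin 3 → A) : A :=
  -8 * algebraMap k A c ^ 2 *
    aeval (fun j => polar q x (grad f x ⨯₃ v) 2 * x j
      + (aeval x U * ∑ i, algebraMap k A (l i) * (grad q x ⨯₃ v) i) * (grad f x ⨯₃ v) j) U

/-- Along a bitangent, the residual discriminant is proportional to the quadratic form cutting out
the contact points, and the factor is the cofactor `U` at the other contact point. -/
lemma tangentDisc_mul_cofactor {f q U : MvPolynomial (Fin 3) k} {l : Fin 3 → k} {c : k}
    (hf : f = lin l * U + C c * q ^ 2) (hq : q.IsHomogeneous 2) (hU : U.IsHomogeneous 3)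
    (v x : Fin 3 → A) (hx : aeval x (lin l) = 0) (hqx : aeval x q ^ 2 = 0) :
    tangentDisc f v x * aeval x U = aeval x q * contactFactor f q U l c v x := by
  rw [contactFactor]
  set y := grad f x ⨯₃ v with hy
  set κ := ∑ i, algebraMap k A (l i) * (grad q x ⨯₃ v) i with hκ
  have g := grad_lin_mul_add hf x hx
  have hly : aeval y (lin l) = 2 * algebraMap k A c * aeval x q * κ := by
    rw [aeval_lin, hκ, hy]
    simp only [Fin.sum_univ_three, cross_apply, g]
    simp
    ring
  have hq1 : polar q x y 1 = -(aeval x U * κ) := by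
    rw [polar_one, hκ, hy]
    change ∑ j, grad q x j * _ = _
    simp only [Fin.sum_univ_three, cross_apply, g]
    simp
    ring
  have hr := polar_lin_mul_add hf hq hU x y
  rw [aeval_expand_self hU]
  simp only [Finset.sum_range_succ, Finset.sum_range_zero, polar_zero]
  rw [hx, hly, hq1] at hr
  generalize polar U x y 1 = u1 at hr ⊢
  generalize polar U x y 2 = u2 at hr ⊢
  generalize polar U x y 3 = u3 at hr ⊢
  generalize polar q x y 2 = q2 at hr ⊢
  rw [tangentDisc, ← hy]
  generalize aeval x q = q0 at *
  generalize aeval x U = u0 at *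
  generalize algebraMap k A c = c' at *
  clear_value κ y
  have key : restrictLine f x y = Polynomial.C (c' * q0 ^ 2)
      + Polynomial.C (2 * c' * q0 * κ * u0 - 2 * c' * q0 * (u0 * κ)) * Polynomial.X ^ 1
      + Polynomial.C (2 * c' * q0 * κ * u1 + c' * (2 * q0 * q2 + (u0 * κ) ^ 2)) * Polynomial.X ^ 2
      + Polynomial.C (2 * c' * q0 * κ * u2 - 2 * c' * (u0 * κ) * q2) * Polynomial.X ^ 3
      + Polynomial.C (2 * c' * q0 * κ * u3 + c' * q2 ^ 2) * Polynomial.X ^ 4 := by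
    rw [hr]
    simp only [Polynomial.C_mul, Polynomial.C_add, Polynomial.C_sub, Polynomial.C_neg,
      Polynomial.C_pow, map_zero, show Polynomial.C (2 : A) = 2 from map_ofNat Polynomial.C 2]
    ring
  have e2 : polar f x y 2 = 2 * c' * q0 * κ * u1 + c' * (2 * q0 * q2 + (u0 * κ) ^ 2) := by
    rw [polar, key]
    simp only [Polynomial.coeff_add, Polynomial.coeff_C_mul, Polynomial.coeff_X_pow,
      Polynomial.coeff_C]
    norm_num
  have e3 : polar f x y 3 = 2 * c' * q0 * κ * u2 - 2 * c' * (u0 * κ) * q2 := by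
    rw [polar, key]
    simp only [Polynomial.coeff_add, Polynomial.coeff_C_mul, Polynomial.coeff_X_pow,
      Polynomial.coeff_C]
    norm_num
  have e4 : polar f x y 4 = 2 * c' * q0 * κ * u3 + c' * q2 ^ 2 := by
    rw [polar, key]
    simp only [Polynomial.coeff_add, Polynomial.coeff_C_mul, Polynomial.coeff_X_pow,
      Polynomial.coeff_C]
    norm_num
  rw [residualDisc, e2, e3, e4]
  linear_combination (u0 * (4 * c' ^ 2 * κ ^ 2 * u2 ^ 2
    - 4 * ((2 * c' * κ * u1 + 2 * c' * q2) * (2 * c' * κ * u3)))) * hqx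

lemma grad_map (φ : A →ₐ[k] B) (h : MvPolynomial (Fin 3) k) (x : Fin 3 → A) :
    grad h (fun j => φ (x j)) = fun j => φ (grad h x j) := by
  funext j
  simp only [grad]
  rw [← AlgHom.comp_apply, comp_aeval]

lemma cross_map (φ : A →ₐ[k] B) (x y : Fin 3 → A) :
    (fun j => φ (x j)) ⨯₃ (fun j => φ (y j)) = fun j => φ ((x ⨯₃ y) j) := by
  funext j
  fin_cases j <;> simp [cross_apply]

lemma tangentDisc_map (φ : A →ₐ[k] B) (h : MvPolynomial (Fin 3) k) (v x : Fin 3 → A) :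
    tangentDisc h (fun j => φ (v j)) (fun j => φ (x j)) = φ (tangentDisc h v x) := by
  simp only [tangentDisc, residualDisc, grad_map, cross_map, polar_map, map_sub, map_mul, map_pow,
    map_ofNat]

lemma contactFactor_map (φ : A →ₐ[k] B) (f q U : MvPolynomial (Fin 3) k) (l : Fin 3 → k) (c : k)
    (v x : Fin 3 → A) :
    contactFactor f q U l c (fun j => φ (v j)) (fun j => φ (x j))
      = φ (contactFactor f q U l c v x) := by
  have hU : ∀ (h : MvPolynomial (Fin 3) k) (z : Fin 3 → A),
      aeval (fun j => φ (z j)) h = φ (aeval z h) := by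
    intro h z
    rw [← AlgHom.comp_apply, comp_aeval]
  simp only [contactFactor, grad_map, cross_map, polar_map, hU, ← AlgHom.commutes φ, ← map_mul,
    ← map_add, ← map_sum, ← map_pow]
  rw [← map_ofNat φ 8]
  simp only [← map_neg, ← map_mul]

end Polar

section Field

variable {k : Type*} [Field k]

lemma eval_smul_homog {d : ℕ} {h : MvPolynomial (Fin 3) k} (hh : h.IsHomogeneous d)
    (p : Fin 3 → k) (t : k) : eval (fun j => t * p j) h = t ^ d * eval p h := by
  have := aeval_expand_self hh p p t 0
  rw [Finset.sum_range_succ'] at this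
  simpa [polar_zero, aeval_eq_eval] using this

lemma eval_lin (u p : Fin 3 → k) : eval p (lin u) = ∑ j, u j * p j := by
  simp [lin]

lemma lin_isHomogeneous (u : Fin 3 → k) : (lin u).IsHomogeneous 1 :=
  IsHomogeneous.sum _ _ _ fun j _ => by simpa using isHomogeneous_C_mul_X (u j) j

lemma exists_ne_zero_coord {u : Fin 3 → k} (hu : u ≠ 0) : ∃ i, u i ≠ 0 := by
  by_contra! h
  exact hu (funext h)

lemma parallel_of_cross_eq_zero {w z : Fin 3 → k} (hz : z ≠ 0) (h : w ⨯₃ z = 0) :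
    ∃ τ : k, w = fun j => τ * z j := by
  obtain ⟨i, hi⟩ := exists_ne_zero_coord hz
  refine ⟨w i / z i, ?_⟩
  rw [cross_apply] at h
  have h0 := congrFun h 0
  have h1 := congrFun h 1
  have h2 := congrFun h 2
  simp at h0 h1 h2
  funext j
  field_simp
  fin_cases i <;> fin_cases j <;> simp <;> grind

lemma cross_parallel {l x p : Fin 3 → k} (hl : l ≠ 0) (hx : ∑ j, l j * x j = 0)
    (hp : ∑ j, l j * p j = 0) : ∃ μ : k, x ⨯₃ p = fun j => μ * l j := by
  refine parallel_of_cross_eq_zero hl ?_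
  rw [Fin.sum_univ_three] at hx hp
  rw [cross_apply]
  funext j
  fin_cases j <;> simp [cross_apply]
  · linear_combination p 0 * hx - x 0 * hp
  · linear_combination p 1 * hx - x 1 * hp
  · linear_combination p 2 * hx - x 2 * hp

/-- Substitution projecting onto the line `lin u = 0` along the `i`-th coordinate. -/
noncomputable def project (u : Fin 3 → k) (i : Fin 3) :
    MvPolynomial (Fin 3) k →ₐ[k] MvPolynomial (Fin 3) k :=
  aeval (fun j => if j = i then X i - C (u i)⁻¹ * lin u else X j)

lemma lin_dvd_sub_project (u : Fin 3 → k) (i : Fin 3) (h : MvPolynomial (Fin 3) k) :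
    lin u ∣ h - project u i h := by
  induction h using MvPolynomial.induction_on with
  | C a => simp [project]
  | add p q hp hq =>
    rw [map_add, add_sub_add_comm]
    exact dvd_add hp hq
  | mul_X p j hp =>
    have hj : lin u ∣ X j - project u i (X j) := by
      by_cases hji : j = i
      · subst hji
        simp [project]
      · simp [project, hji]
    have : p * X j - project u i (p * X j)
        = (p - project u i p) * X j + project u i p * (X j - project u i (X j)) := by
      rw [map_mul]; ring
    rw [this]
    exact dvd_add (hp.mul_right _) (hj.mul_left _)

lemma eval_project (u : Fin 3 → k) (i : Fin 3) (h : MvPolynomial (Fin 3) k) (p : Fin 3 → k) :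
    eval p (project u i h)
      = eval (fun j => if j = i then p i - (u i)⁻¹ * ∑ l, u l * p l else p j) h := by
  rw [← eval_lin u p, ← aeval_eq_eval, ← aeval_eq_eval]
  change aeval p (aeval _ h) = _
  rw [← AlgHom.comp_apply, comp_aeval]
  congr 2
  funext j
  split_ifs <;> simp [aeval_eq_eval]

lemma project_point_mem {u : Fin 3 → k} {i : Fin 3} (hi : u i ≠ 0) (p : Fin 3 → k) :
    ∑ j, u j * (if j = i then p i - (u i)⁻¹ * ∑ l, u l * p l else p j) = 0 := by
  rw [Fin.sum_univ_three, Fin.sum_univ_three]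
  fin_cases i <;> simp at hi ⊢ <;> field_simp <;> ring

lemma eval_project_of_mem {u : Fin 3 → k} (i : Fin 3) (h : MvPolynomial (Fin 3) k) {p : Fin 3 → k}
    (hp : ∑ j, u j * p j = 0) : eval p (project u i h) = eval p h := by
  rw [eval_project, hp]
  congr 2
  funext j
  split_ifs with hj
  · simp [hj]
  · rfl

lemma project_lin {u : Fin 3 → k} {i : Fin 3} (hi : u i ≠ 0) : project u i (lin u) = 0 := by
  have hC : (C (u i) * C (u i)⁻¹ : MvPolynomial (Fin 3) k) = 1 := by
    rw [← C_mul, mul_inv_cancel₀ hi, C_1]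
  have e : project u i (lin u)
      = lin u - (C (u i) * C (u i)⁻¹) * lin u := by
    conv_lhs => rw [lin, project, map_sum]
    conv_rhs => enter [1]; rw [lin]
    fin_cases i <;> simp [Fin.sum_univ_three, algebraMap_eq] <;> ring
  rw [e, hC, one_mul, sub_self]

lemma lin_dvd_of_vanish [Infinite k] {u : Fin 3 → k} (hu : u ≠ 0) {h : MvPolynomial (Fin 3) k}
    (hv : ∀ p : Fin 3 → k, ∑ j, u j * p j = 0 → eval p h = 0) : lin u ∣ h := by
  obtain ⟨i, hi⟩ := exists_ne_zero_coord hu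
  have : project u i h = 0 := by
    apply MvPolynomial.funext
    intro p
    rw [eval_project, map_zero]
    exact hv _ (project_point_mem hi p)
  simpa [this] using lin_dvd_sub_project u i h

lemma lin_ne_zero {u : Fin 3 → k} (hu : u ≠ 0) : lin u ≠ 0 := by
  obtain ⟨i, hi⟩ := exists_ne_zero_coord hu
  intro h
  apply hi
  have := eval_lin u (Pi.single i 1)
  rw [h] at this
  simpa [Pi.single_apply] using this.symm

lemma exists_other (i : Fin 3) : ∃ j₁ j₂ : Fin 3, j₁ ≠ i ∧ j₂ ≠ i ∧ j₁ ≠ j₂ := by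
  fin_cases i
  · exact ⟨1, 2, by decide⟩
  · exact ⟨0, 2, by decide⟩
  · exact ⟨0, 1, by decide⟩

lemma mem_radical_of_vanish [IsAlgClosed k] {I : Ideal (MvPolynomial (Fin 3) k)}
    {h : MvPolynomial (Fin 3) k}
    (hv : ∀ p : Fin 3 → k, (∀ s ∈ I, eval p s = 0) → eval p h = 0) : ∃ N : ℕ, h ^ N ∈ I := by
  have : h ∈ I.radical := by
    rw [← vanishingIdeal_zeroLocus_eq_radical (K := k), mem_vanishingIdeal_iff]
    intro p hp
    rw [aeval_eq_eval]
    refine hv p fun s hs => ?_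
    have := (mem_zeroLocus_iff.1 hp) s hs
    rwa [aeval_eq_eval] at this
  exact this

lemma isRelPrime_project [IsAlgClosed k] {u : Fin 3 → k} {i : Fin 3} (hi : u i ≠ 0)
    {f b : MvPolynomial (Fin 3) k}
    (hV : ∀ p : Fin 3 → k, ∑ j, u j * p j = 0 → eval p f = 0 → eval p b = 0 → p = 0) :
    IsRelPrime (project u i f) (project u i b) := by
  have hX : ∀ j, j ≠ i → ∃ N : ℕ, (X j : MvPolynomial (Fin 3) k) ^ N
      ∈ Ideal.span {project u i f, project u i b} := by
    intro j hj
    apply mem_radical_of_vanish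
    intro p hp
    have h1 := hp _ (Ideal.subset_span (Set.mem_insert _ _))
    have h2 := hp _ (Ideal.subset_span (Set.mem_insert_of_mem _ rfl))
    rw [eval_project] at h1 h2
    have := congrFun (hV _ (project_point_mem hi p) h1 h2) j
    simpa [hj] using this
  obtain ⟨j₁, j₂, h₁, h₂, h₁₂⟩ := exists_other i
  obtain ⟨N₁, hN₁⟩ := hX j₁ h₁
  obtain ⟨N₂, hN₂⟩ := hX j₂ h₂
  intro d hdf hdb
  have hd : ∀ z ∈ Ideal.span {project u i f, project u i b}, d ∣ z := by
    intro z hz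
    obtain ⟨α, β, rfl⟩ := Ideal.mem_span_pair.1 hz
    exact dvd_add (hdf.mul_left _) (hdb.mul_left _)
  have hirr : Irreducible (X j₁ : MvPolynomial (Fin 3) k) := (X_prime (R := k) (i := j₁)).irreducible
  have hrel : IsRelPrime (X j₁ : MvPolynomial (Fin 3) k) (X j₂) := by
    rw [hirr.isRelPrime_iff_not_dvd, X_dvd_X]
    simpa using h₁₂
  exact (hrel.pow (m := N₁) (n := N₂)) (hd _ hN₁) (hd _ hN₂)

/-- If two curves have no common point on the line `lin u = 0`, then `lin u` is a nonzerodivisor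
modulo their equations. -/
lemma mem_of_lin_mul_mem [IsAlgClosed k] {u : Fin 3 → k} (hu : u ≠ 0)
    {f b h : MvPolynomial (Fin 3) k}
    (hV : ∀ p : Fin 3 → k, ∑ j, u j * p j = 0 → eval p f = 0 → eval p b = 0 → p = 0)
    (hf : ∃ p : Fin 3 → k, ∑ j, u j * p j = 0 ∧ eval p f ≠ 0)
    (hmem : lin u * h ∈ Ideal.span {f, b}) : h ∈ Ideal.span {f, b} := by
  obtain ⟨i, hi⟩ := exists_ne_zero_coord hu
  obtain ⟨α, β, hαβ⟩ := Ideal.mem_span_pair.1 hmem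
  have hrel := isRelPrime_project hi hV
  have he : project u i α * project u i f + project u i β * project u i b = 0 := by
    rw [← map_mul, ← map_mul, ← map_add, hαβ, map_mul, project_lin hi, zero_mul]
  have hf0 : project u i f ≠ 0 := by
    obtain ⟨p, hp, hfp⟩ := hf
    intro h0
    apply hfp
    rw [← eval_project_of_mem i f hp, h0, map_zero]
  obtain ⟨γ, hγ⟩ : project u i f ∣ project u i β := by
    refine hrel.dvd_of_dvd_mul_right ⟨-project u i α, ?_⟩
    linear_combination he
  have hα : project u i α = -(γ * project u i b) := by
    apply mul_left_cancel₀ hf0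
    rw [hγ] at he
    linear_combination he
  obtain ⟨α₁, hα₁⟩ := lin_dvd_sub_project u i α
  obtain ⟨β₁, hβ₁⟩ := lin_dvd_sub_project u i β
  obtain ⟨f₁, hf₁⟩ := lin_dvd_sub_project u i f
  obtain ⟨b₁, hb₁⟩ := lin_dvd_sub_project u i b
  refine Ideal.mem_span_pair.2 ⟨α₁ + γ * b₁, β₁ - γ * f₁, ?_⟩
  apply mul_left_cancel₀ (lin_ne_zero hu)
  rw [← hαβ]
  linear_combination (-f) * hα₁ - b * hβ₁ + γ * b * hf₁ - γ * f * hb₁ - f * hα - b * hγ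

/-- Local membership at all common points of two plane curves implies membership. -/
lemma mem_of_local_mem [IsAlgClosed k] {u : Fin 3 → k} (hu : u ≠ 0)
    {f a b : MvPolynomial (Fin 3) k}
    (hV : ∀ p : Fin 3 → k, ∑ j, u j * p j = 0 → eval p f = 0 → eval p b = 0 → p = 0)
    (hf : ∃ p : Fin 3 → k, ∑ j, u j * p j = 0 ∧ eval p f ≠ 0)
    (hloc : ∀ p : Fin 3 → k, p ≠ 0 → eval p f = 0 → eval p b = 0 →
      ∃ s, eval p s ≠ 0 ∧ s * a ∈ Ideal.span {f, b}) :
    a ∈ Ideal.span {f, b} := by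
  set J := Ideal.span {f, b} with hJ
  let I : Ideal (MvPolynomial (Fin 3) k) :=
    Submodule.comap (LinearMap.toSpanSingleton _ _ a) J
  have hI : ∀ s, s ∈ I ↔ s * a ∈ J := fun s => Iff.rfl
  obtain ⟨N, hN⟩ : ∃ N : ℕ, lin u ^ N ∈ I := by
    apply mem_radical_of_vanish
    intro p hp
    have hp0 : p = 0 := by
      by_contra hne
      have h1 := hp f ((hI f).2 (J.mul_mem_right _ (Ideal.subset_span (Set.mem_insert _ _))))
      have h2 := hp b ((hI b).2
        (J.mul_mem_right _ (Ideal.subset_span (Set.mem_insert_of_mem _ rfl))))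
      obtain ⟨s, hs, hsa⟩ := hloc p hne h1 h2
      exact hs (hp s ((hI s).2 hsa))
    rw [hp0, eval_lin]
    simp
  rw [hI] at hN
  induction N with
  | zero => simpa using hN
  | succ N ih =>
    refine ih (mem_of_lin_mul_mem hu hV hf ?_)
    rwa [← mul_assoc, ← pow_succ']

lemma degree_le_of_mem [Infinite k] {f a b : MvPolynomial (Fin 3) k} {d e n : ℕ}
    (hf : f.IsHomogeneous n) {p : Fin 3 → k} (hfp : eval p f = 0) (hap : eval p a ≠ 0)
    (ha : ∀ t : k, eval (fun j => t * p j) a = t ^ d * eval p a)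
    (hb : ∀ t : k, eval (fun j => t * p j) b = t ^ e * eval p b)
    (hmem : a ∈ Ideal.span {f, b}) : e ≤ d := by
  obtain ⟨α, β, hαβ⟩ := Ideal.mem_span_pair.1 hmem
  let P : Polynomial k := aeval (fun j => Polynomial.X * Polynomial.C (p j)) β
  have hP : ∀ t, P.eval t = eval (fun j => t * p j) β := by
    intro t
    rw [← Polynomial.coe_aeval_eq_eval, ← aeval_eq_eval]
    change Polynomial.aeval t (aeval _ β) = _
    rw [← AlgHom.comp_apply, comp_aeval]
    simp [aeval_eq_eval, mul_comm _ t]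
  have key : Polynomial.C (eval p a) * Polynomial.X ^ d
      = Polynomial.X ^ e * (Polynomial.C (eval p b) * P) := by
    apply Polynomial.funext
    intro t
    have := congrArg (eval (fun j => t * p j)) hαβ
    rw [map_add, map_mul, map_mul, eval_smul_homog hf, hfp, ha, hb] at this
    simp only [Polynomial.eval_mul, Polynomial.eval_C, Polynomial.eval_pow, Polynomial.eval_X, hP]
    linear_combination -this
  by_contra! hlt
  have := Polynomial.X_pow_dvd_iff.1 (Dvd.intro _ key.symm) d hlt
  simp at this
  exact hap this

lemma eval_restrictLine (h : MvPolynomial (Fin 3) k) (x y : Fin 3 → k) (t : k) :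
    (restrictLine h x y).eval t = eval (fun j => x j + t * y j) h := by
  rw [restrictLine, ← Polynomial.coe_aeval_eq_eval, ← aeval_eq_eval]
  change Polynomial.aeval t (aeval _ h) = _
  rw [← AlgHom.comp_apply, comp_aeval]
  simp [mul_comm _ t]

lemma eval_zero_homog {d : ℕ} (hd : d ≠ 0) {h : MvPolynomial (Fin 3) k} (hh : h.IsHomogeneous d) :
    eval 0 h = 0 := by
  have := eval_smul_homog hh 0 0
  simpa [hd] using this

lemma exists_zero_on_line [IsAlgClosed k] {d : ℕ} (hd : d ≠ 0) {h : MvPolynomial (Fin 3) k}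
    (hh : h.IsHomogeneous d) (x y : Fin 3 → k) :
    ∃ s t : k, (s ≠ 0 ∨ t ≠ 0) ∧ eval (fun j => s * x j + t * y j) h = 0 := by
  by_cases hx : eval x h = 0
  · exact ⟨1, 0, Or.inl one_ne_zero, by simpa using hx⟩
  have hc : (restrictLine h y x).coeff d = eval x h := by
    have := aeval_expand_self hh y x 0 1
    rw [Finset.sum_range_succ, Finset.sum_eq_zero] at this
    · simpa [aeval_eq_eval, polar] using this.symm
    · intro i hi
      rw [Finset.mem_range] at hi
      rw [zero_pow (by omega)]
      simp
  obtain ⟨s, hs⟩ := IsAlgClosed.exists_root (restrictLine h y x) (by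
    intro h0
    have := Polynomial.coeff_eq_zero_of_degree_lt (p := restrictLine h y x) (n := d) (by
      rw [h0]; exact_mod_cast Nat.pos_of_ne_zero hd)
    exact hx (hc ▸ this))
  refine ⟨s, 1, Or.inr one_ne_zero, ?_⟩
  rw [Polynomial.IsRoot, eval_restrictLine] at hs
  simpa [add_comm] using hs

/-- A ternary form of positive degree has a zero on every line. -/
lemma exists_zero_mem_line [IsAlgClosed k] {d : ℕ} (hd : d ≠ 0) {h : MvPolynomial (Fin 3) k}
    (hh : h.IsHomogeneous d) {l : Fin 3 → k} (hl : l ≠ 0) :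
    ∃ p : Fin 3 → k, p ≠ 0 ∧ ∑ j, l j * p j = 0 ∧ eval p h = 0 := by
  obtain ⟨i, hi⟩ := exists_ne_zero_coord hl
  obtain ⟨j₁, j₂, h₁, h₂, h₁₂⟩ := exists_other i
  let y : Fin 3 → Fin 3 → k := fun j => Pi.single j (l i) - Pi.single i (l j)
  have hy : ∀ j, ∑ m, l m * y j m = 0 := by
    intro j
    simp [y, mul_sub, Finset.sum_sub_distrib, Pi.single_apply, mul_comm]
  obtain ⟨s, t, hst, h0⟩ := exists_zero_on_line hd hh (y j₁) (y j₂)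
  refine ⟨fun j => s * y j₁ j + t * y j₂ j, ?_, ?_, h0⟩
  · intro h0
    have e1 := congrFun h0 j₁
    have e2 := congrFun h0 j₂
    simp [y, h₁, h₂, h₁₂, h₁₂.symm, hi] at e1 e2
    simp [e1, e2] at hst
  · have : ∑ j, l j * (s * y j₁ j + t * y j₂ j)
        = s * ∑ j, l j * y j₁ j + t * ∑ j, l j * y j₂ j := by
      simp only [Finset.mul_sum, ← Finset.sum_add_distrib]
      exact Finset.sum_congr rfl fun j _ => by ring
    rw [this, hy, hy]
    ring

/-- A smooth quartic contains no line. -/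
lemma exists_ne_zero_on_line [IsAlgClosed k] {f : MvPolynomial (Fin 3) k} (hf : f.IsHomogeneous 4)
    (hsm : ∀ p : Fin 3 → k, p ≠ 0 → eval p f = 0 → ∃ i, eval p (pderiv i f) ≠ 0)
    {l : Fin 3 → k} (hl : l ≠ 0) : ∃ p : Fin 3 → k, ∑ j, l j * p j = 0 ∧ eval p f ≠ 0 := by
  by_contra! h
  obtain ⟨i, hi⟩ := exists_ne_zero_coord hl
  obtain ⟨p, hp0, hlp, h0⟩ := exists_zero_mem_line (by norm_num) (hf.pderiv (i := i)) hl
  obtain ⟨j, hj⟩ := hsm p hp0 (h p hlp)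
  let y : Fin 3 → k := Pi.single j (l i) - Pi.single i (l j)
  have hy : ∀ g : Fin 3 → k, ∑ m, g m * y m = g j * l i - g i * l j := by
    intro g
    simp [y, mul_sub, Finset.sum_sub_distrib, Pi.single_apply]
  have hr : restrictLine f p y = 0 := by
    apply Polynomial.funext
    intro t
    rw [eval_restrictLine, Polynomial.eval_zero]
    apply h
    have : ∑ m, l m * (p m + t * y m) = ∑ m, l m * p m + t * ∑ m, l m * y m := by
      simp only [Finset.mul_sum, ← Finset.sum_add_distrib]
      exact Finset.sum_congr rfl fun j _ => by ring
    rw [this, hlp, hy]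
    ring
  have h1 := polar_one f p y
  rw [polar, hr, Polynomial.coeff_zero, hy, aeval_eq_eval] at h1
  change 0 = _ - eval p (pderiv i f) * _ at h1
  rw [h0, zero_mul, sub_zero] at h1
  exact mul_ne_zero hj hi h1.symm

/-- A general line meets each of finitely many given lines away from the curve. -/
lemma exists_generic_line [Infinite k] {f : MvPolynomial (Fin 3) k} (hf : f.IsHomogeneous 4)
    (S : Finset (Fin 3 → k))
    (hS : ∀ l ∈ S, l ≠ 0 ∧ ∃ p : Fin 3 → k, ∑ j, l j * p j = 0 ∧ eval p f ≠ 0) :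
    ∃ u : Fin 3 → k, u ≠ 0 ∧ ∀ l ∈ S, ∀ p : Fin 3 → k, ∑ j, l j * p j = 0 →
      ∑ j, u j * p j = 0 → eval p f = 0 → p = 0 := by
  let F : (Fin 3 → k) → MvPolynomial (Fin 3) k := fun l => aeval ((fun j => C (l j)) ⨯₃ X) f
  have hF : ∀ l u, eval u (F l) = eval (l ⨯₃ u) f := by
    intro l u
    rw [← aeval_eq_eval, ← aeval_eq_eval]
    change aeval u (aeval _ f) = _
    rw [← AlgHom.comp_apply, comp_aeval]
    congr 2
    funext j
    fin_cases j <;> simp [cross_apply]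
  have hne : X 0 * ∏ l ∈ S, F l ≠ 0 := by
    refine mul_ne_zero (X_ne_zero 0) (Finset.prod_ne_zero_iff.2 fun l hl h0 => ?_)
    obtain ⟨hl0, p, hp, hfp⟩ := hS l hl
    obtain ⟨i, hi⟩ := exists_ne_zero_coord hl0
    apply hfp
    have := hF l (p ⨯₃ (Pi.single i (l i)⁻¹))
    rw [h0, map_zero] at this
    rw [this]
    congr 2
    rw [Fin.sum_univ_three] at hp
    funext j
    fin_cases i <;> fin_cases j <;> simp [cross_apply] at hi ⊢ <;> field_simp <;>
      linear_combination hp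
  obtain ⟨u, hu⟩ : ∃ u, eval u (X 0 * ∏ l ∈ S, F l) ≠ 0 := by
    by_contra! hcon
    exact hne (MvPolynomial.funext fun x => by rw [hcon, map_zero])
  rw [map_mul, eval_X, map_prod] at hu
  refine ⟨u, fun h0 => hu (by simp [h0]), fun l hl p hlp hup hfp => ?_⟩
  have hlu : eval (l ⨯₃ u) f ≠ 0 := by
    rw [← hF]
    exact Finset.prod_ne_zero_iff.1 (right_ne_zero_of_mul hu) l hl
  have hlu0 : l ⨯₃ u ≠ 0 := by
    intro h0
    rw [h0] at hlu
    exact hlu (eval_zero_homog (by norm_num) hf)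
  obtain ⟨τ, hτ⟩ := parallel_of_cross_eq_zero (w := p) hlu0 (by
    rw [Fin.sum_univ_three] at hlp hup
    funext j
    fin_cases j <;> simp [cross_apply]
    · linear_combination l 0 * hup - u 0 * hlp
    · linear_combination l 1 * hup - u 1 * hlp
    · linear_combination l 2 * hup - u 2 * hlp)
  rw [hτ, eval_smul_homog hf] at hfp
  have hτ0 : τ = 0 := by simpa [hlu] using hfp
  rw [hτ, hτ0]
  funext j
  simp

lemma sum_mul_eq_of_cross {p x l v : Fin 3 → k} {μ : k} (h : p ⨯₃ x = fun j => μ * l j)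
    (j : Fin 3) :
    (∑ i, p i * v i) * x j = (∑ i, x i * v i) * p j + μ * (l ⨯₃ v) j := by
  have h0 := congrFun h 0
  have h1 := congrFun h 1
  have h2 := congrFun h 2
  simp [cross_apply] at h0 h1 h2
  rw [Fin.sum_univ_three, Fin.sum_univ_three]
  fin_cases j <;> simp [cross_apply]
  · linear_combination v 2 * h1 - v 1 * h2
  · linear_combination v 0 * h2 - v 2 * h0
  · linear_combination v 1 * h0 - v 0 * h1

lemma homogeneousComponent_mul_of_left {m : ℕ} {a : MvPolynomial (Fin 3) k}
    (ha : a.IsHomogeneous m) (U : MvPolynomial (Fin 3) k) (n : ℕ) :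
    homogeneousComponent (m + n) (a * U) = a * homogeneousComponent n U := by
  have h : ∀ i, homogeneousComponent (m + n) (a * homogeneousComponent i U)
      = if i = n then a * homogeneousComponent n U else 0 := by
    intro i
    rw [homogeneousComponent_of_mem (ha.mul (homogeneousComponent_isHomogeneous i U))]
    split_ifs <;> first | omega | simp_all
  conv_lhs => rw [← sum_homogeneousComponent U, Finset.mul_sum, map_sum]
  simp only [h, Finset.sum_ite_eq', Finset.mem_range]
  split_ifs with hn
  · rfl
  · rw [homogeneousComponent_eq_zero n U (by omega), mul_zero]

/-- The equation of a quartic along one of its bitangents. -/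
lemma exists_decomposition [IsAlgClosed k] {f : MvPolynomial (Fin 3) k}
    (hf : f.IsHomogeneous 4) {l : Fin 3 → k} (hl : IsBitangentLine f l) :
    ∃ (q U : MvPolynomial (Fin 3) k) (c : k), c ≠ 0 ∧ q.IsHomogeneous 2 ∧ U.IsHomogeneous 3 ∧
      f = lin l * U + C c * q ^ 2 ∧ ∃ p : Fin 3 → k, ∑ j, l j * p j = 0 ∧ eval p q ≠ 0 := by
  obtain ⟨hl0, q, c, hc, hq, hp, hfq⟩ := hl
  obtain ⟨U, hU⟩ : lin l ∣ f - C c * q ^ 2 := by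
    refine lin_dvd_of_vanish hl0 fun p hlp => ?_
    simp [hfq p hlp]
  refine ⟨q, homogeneousComponent 3 U, c, hc, hq, homogeneousComponent_isHomogeneous 3 U, ?_, hp⟩
  have h4 : (f - C c * q ^ 2).IsHomogeneous 4 := hf.sub ((hq.pow 2).C_mul c)
  have e3 := homogeneousComponent_mul_of_left (lin_isHomogeneous l) U 3
  rw [← e3, ← hU, homogeneousComponent_eq_self h4]
  ring

/-- At a contact point the gradient of the quartic is a nonzero multiple of the bitangent. -/
lemma cofactor_ne_zero {f q U : MvPolynomial (Fin 3) k} {l : Fin 3 → k} {c : k}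
    (hF : f = lin l * U + C c * q ^ 2)
    (hsm : ∀ p : Fin 3 → k, p ≠ 0 → eval p f = 0 → ∃ i, eval p (pderiv i f) ≠ 0)
    {p : Fin 3 → k} (hp : p ≠ 0) (hlp : ∑ j, l j * p j = 0) (hqp : eval p q = 0) :
    eval p U ≠ 0 ∧ ∀ j, grad f p j = eval p U * l j := by
  have hl0 : eval p (lin l) = 0 := by rw [eval_lin, hlp]
  have hg : ∀ j, grad f p j = eval p U * l j := by
    intro j
    have := grad_lin_mul_add hF p (by rw [aeval_eq_eval]; exact hl0) j
    simpa [aeval_eq_eval, hqp] using this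
  refine ⟨fun h0 => ?_, hg⟩
  obtain ⟨i, hi⟩ := hsm p hp (by simp [hF, hl0, hqp])
  apply hi
  have := hg i
  rw [h0, zero_mul] at this
  simpa [grad, aeval_eq_eval] using this

/-- A zero of the tangent discriminant on the curve is a contact point of a bitangent. -/
lemma isBitangentLine_grad [IsAlgClosed k] (h2 : (2 : k) ≠ 0) {f : MvPolynomial (Fin 3) k}
    (hf : f.IsHomogeneous 4)
    (hsm : ∀ p : Fin 3 → k, p ≠ 0 → eval p f = 0 → ∃ i, eval p (pderiv i f) ≠ 0)
    {p v : Fin 3 → k} (hp : p ≠ 0) (hfp : eval p f = 0) (hpv : ∑ j, p j * v j ≠ 0)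
    (hd : tangentDisc f v p = 0) : IsBitangentLine f (grad f p) := by
  obtain ⟨i, hi⟩ := hsm p hp hfp
  have hE : ∑ j, grad f p j * p j = 0 := by
    have := euler hf p
    rw [aeval_eq_eval] at this
    change _ = _ * eval p f at this
    rw [hfp, mul_zero] at this
    rw [← this]
    exact Finset.sum_congr rfl fun j _ => mul_comm _ _
  have hi : grad f p i ≠ 0 := by simpa [grad, aeval_eq_eval] using hi
  set n := grad f p with hn
  have hn0 : n ≠ 0 := fun h => hi (by rw [h]; rfl)
  refine ⟨hn0, ?_⟩
  set y := n ⨯₃ v with hy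
  have p0 : polar f p y 0 = 0 := by rw [polar_zero, aeval_eq_eval]; exact hfp
  have p1 : polar f p y 1 = 0 := by
    rw [polar_one]
    change ∑ j, n j * y j = 0
    rw [hy, Fin.sum_univ_three]
    simp [cross_apply]
    ring
  obtain ⟨c, α, β, hc⟩ : ∃ c α β : k, ∀ s t : k,
      polar f p y 2 * s ^ 2 + polar f p y 3 * s * t + polar f p y 4 * t ^ 2
        = c * (α * s + β * t) ^ 2 := by
    rw [tangentDisc, residualDisc, ← hn, ← hy] at hd
    by_cases h4 : polar f p y 4 = 0
    · refine ⟨polar f p y 2, 1, 0, fun s t => ?_⟩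
      have h3 : polar f p y 3 = 0 := by simpa [h4] using hd
      rw [h3, h4]
      ring
    · refine ⟨polar f p y 4, polar f p y 3 / (2 * polar f p y 4), 1, fun s t => ?_⟩
      field_simp
      linear_combination (-s ^ 2) * hd
  let A : MvPolynomial (Fin 3) k := C (∑ j, p j * v j)⁻¹ * lin v
  let T : MvPolynomial (Fin 3) k := C ((∑ j, p j * v j) * n i)⁻¹ * lin (Pi.single i 1 ⨯₃ p)
  have hA : A.IsHomogeneous 1 := (lin_isHomogeneous v).C_mul _
  have hT : T.IsHomogeneous 1 := (lin_isHomogeneous _).C_mul _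
  have hq : (T * (C α * A + C β * T)).IsHomogeneous 2 :=
    hT.mul ((hA.C_mul α).add (hT.C_mul β))
  have key : ∀ x : Fin 3 → k, ∑ j, n j * x j = 0 →
      eval x f = c * (eval x (T * (C α * A + C β * T))) ^ 2 := by
    intro x hx
    obtain ⟨μ, hμ⟩ := cross_parallel hn0 hE hx
    have hAx : eval x A = (∑ j, x j * v j) / ∑ j, p j * v j := by
      simp only [A, map_mul, eval_C, eval_lin]
      rw [div_eq_inv_mul]
      congr 1
      exact Finset.sum_congr rfl fun j _ => mul_comm _ _
    have hTx : eval x T = μ / ∑ j, p j * v j := by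
      have h := congrFun hμ i
      have e : ∑ j, (Pi.single i 1 ⨯₃ p) j * x j = (p ⨯₃ x) i := by
        rw [Fin.sum_univ_three]
        fin_cases i <;> simp [cross_apply] <;> ring
      simp only [T, map_mul, eval_C, eval_lin]
      rw [e, h]
      field_simp
    have hxe : x = fun j => eval x A * p j + eval x T * y j := by
      funext j
      have := sum_mul_eq_of_cross (v := v) hμ j
      rw [hAx, hTx, hy]
      field_simp
      linear_combination this
    have hex := aeval_expand_self hf p y (eval x A) (eval x T)
    rw [← hxe, aeval_eq_eval] at hex
    simp only [Finset.sum_range_succ, Finset.sum_range_zero, p0, p1] at hex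
    change eval x f = _ at hex
    rw [hex]
    simp only [map_mul, map_add, eval_C]
    linear_combination (eval x T) ^ 2 * hc (eval x A) (eval x T)
  obtain ⟨z, hz, hfz⟩ := exists_ne_zero_on_line hf hsm hn0
  rw [key z hz] at hfz
  exact ⟨_, c, left_ne_zero_of_mul hfz, hq,
    ⟨z, hz, fun h0 => hfz (by rw [h0]; simp)⟩, key⟩

/-- The tangent discriminant of a quartic as a polynomial in the point of tangency. -/
noncomputable def tangentForm (f : MvPolynomial (Fin 3) k) (v : Fin 3 → k) :
    MvPolynomial (Fin 3) k :=
  tangentDisc f (fun j => C (v j)) X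

lemma eval_tangentForm (f : MvPolynomial (Fin 3) k) (v p : Fin 3 → k) :
    eval p (tangentForm f v) = tangentDisc f v p := by
  have := tangentDisc_map (aeval p : MvPolynomial (Fin 3) k →ₐ[k] k) f (fun j => C (v j)) X
  rw [tangentForm, ← aeval_eq_eval]
  change aeval p _ = _
  rw [← this]
  congr 1 <;> funext j <;> simp

lemma contactFactor_ne_zero (h2 : (2 : k) ≠ 0) {f q U : MvPolynomial (Fin 3) k} {l : Fin 3 → k}
    {c : k} (hF : f = lin l * U + C c * q ^ 2) (hc : c ≠ 0) (hq : q.IsHomogeneous 2)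
    (hQ : ∃ p : Fin 3 → k, ∑ j, l j * p j = 0 ∧ eval p q ≠ 0) (hl : l ≠ 0)
    (hsm : ∀ p : Fin 3 → k, p ≠ 0 → eval p f = 0 → ∃ i, eval p (pderiv i f) ≠ 0)
    {p v : Fin 3 → k} (hp : p ≠ 0) (hlp : ∑ j, l j * p j = 0) (hqp : eval p q = 0)
    (hpv : ∑ j, p j * v j ≠ 0) : contactFactor f q U l c v p ≠ 0 := by
  obtain ⟨hU, hg⟩ := cofactor_ne_zero hF hsm hp hlp hqp
  have hg' : grad f p = fun j => eval p U * l j := funext hg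
  set y := grad f p ⨯₃ v with hy
  have hyl : ∀ j, y j = eval p U * (l ⨯₃ v) j := by
    intro j
    rw [hy, hg']
    fin_cases j <;> simp [cross_apply] <;> ring
  rw [contactFactor, ← hy]
  simp only [Algebra.algebraMap_self, RingHom.id_apply]
  set κ := ∑ i, l i * (grad q p ⨯₃ v) i with hκ
  set β := polar q p y 2 with hβ
  have hq1 : polar q p y 1 = -(eval p U * κ) := by
    rw [polar_one, hκ]
    change ∑ j, grad q p j * _ = _
    simp only [hyl, Fin.sum_univ_three, cross_apply]
    simp
    ring
  have hq0 : polar q p y 0 = 0 := by rw [polar_zero, aeval_eq_eval]; exact hqp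
  have hqe : ∀ s t, eval (fun j => s * p j + t * y j) q
      = s * t * polar q p y 1 + t ^ 2 * β := by
    intro s t
    have := aeval_expand_self hq p y s t
    simp only [Finset.sum_range_succ, Finset.sum_range_zero, hq0] at this
    rw [aeval_eq_eval] at this
    change eval _ q = _ at this
    rw [this]
    ring
  have hly : ∑ j, l j * y j = 0 := by
    simp only [hyl, Fin.sum_univ_three, cross_apply]
    simp
    ring
  have hvy : ∑ j, v j * y j = 0 := by
    simp only [hyl, Fin.sum_univ_three, cross_apply]
    simp
    ring
  have hz0 : (fun j => β * p j + (aeval p U * κ) * y j) ≠ 0 := by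
    intro h0
    have hβ0 : β = 0 := by
      have : ∑ j, v j * (β * p j + (aeval p U * κ) * y j) = 0 :=
        Finset.sum_eq_zero fun j _ => by rw [congrFun h0 j]; simp
      have e : ∑ j, v j * (β * p j + (aeval p U * κ) * y j)
          = β * ∑ j, p j * v j + (aeval p U * κ) * ∑ j, v j * y j := by
        simp only [Finset.mul_sum, ← Finset.sum_add_distrib]
        exact Finset.sum_congr rfl fun j _ => by ring
      rw [e, hvy, mul_zero, add_zero] at this
      exact (mul_eq_zero.1 this).resolve_right hpv
    have h1 : polar q p y 1 = 0 := by
      have e : polar q p y 1 * polar q p y 1 = -∑ j, grad q p j * ((eval p U * κ) * y j) := by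
        conv_lhs => rw [hq1, neg_mul, ← hq1, polar_one, Finset.mul_sum]
        congr 1
        exact Finset.sum_congr rfl fun j _ => by rw [grad]; ring
      have e' : ∀ j, (eval p U * κ) * y j = 0 := by
        intro j
        have := congrFun h0 j
        simpa [hβ0, aeval_eq_eval] using this
      simpa [e'] using e
    obtain ⟨x, hx, hqx⟩ := hQ
    obtain ⟨μ, hμ⟩ := cross_parallel hl hlp hx
    apply hqx
    have hxe : (fun j => (∑ i, p i * v i) * x j)
        = fun j => (∑ i, x i * v i) * p j + (μ / eval p U) * y j := by
      funext j
      rw [sum_mul_eq_of_cross hμ j, hyl]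
      field_simp
    have := hqe (∑ i, x i * v i) (μ / eval p U)
    rw [← hxe, eval_smul_homog hq, h1, hβ0] at this
    simpa [hpv] using this
  have hlz : ∑ j, l j * (β * p j + (aeval p U * κ) * y j) = 0 := by
    have e : ∑ j, l j * (β * p j + (aeval p U * κ) * y j)
        = β * ∑ j, l j * p j + (aeval p U * κ) * ∑ j, l j * y j := by
      simp only [Finset.mul_sum, ← Finset.sum_add_distrib]
      exact Finset.sum_congr rfl fun j _ => by ring
    rw [e, hlp, hly]
    ring
  have hqz : eval (fun j => β * p j + (aeval p U * κ) * y j) q = 0 := by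
    rw [hqe, hq1, aeval_eq_eval]
    change β * (eval p U * κ) * _ + (eval p U * κ) ^ 2 * β = 0
    ring
  have h8 : (-8 : k) ≠ 0 := by
    rw [show (-8 : k) = -(2 ^ 3) by norm_num]
    exact neg_ne_zero.2 (pow_ne_zero 3 h2)
  refine mul_ne_zero (mul_ne_zero h8 (pow_ne_zero 2 hc)) ?_
  exact (cofactor_ne_zero hF hsm hz0 hlz hqz).1

/-- Near a contact point of a bitangent, the tangent discriminant and the quadratic form cutting
out the contact points agree up to a unit. -/
lemma exists_unit_mul_tangentForm (h2 : (2 : k) ≠ 0) {f q U : MvPolynomial (Fin 3) k}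
    {l : Fin 3 → k} {c : k} (hF : f = lin l * U + C c * q ^ 2) (hc : c ≠ 0)
    (hq : q.IsHomogeneous 2) (hU : U.IsHomogeneous 3)
    (hQ : ∃ p : Fin 3 → k, ∑ j, l j * p j = 0 ∧ eval p q ≠ 0) (hl : l ≠ 0)
    (hsm : ∀ p : Fin 3 → k, p ≠ 0 → eval p f = 0 → ∃ i, eval p (pderiv i f) ≠ 0)
    {p v : Fin 3 → k} (hp : p ≠ 0) (hlp : ∑ j, l j * p j = 0) (hqp : eval p q = 0)
    (hpv : ∑ j, p j * v j ≠ 0) :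
    ∃ s, eval p s ≠ 0 ∧ f ∣ U ^ 2 * tangentForm f v - s * q := by
  set I := Ideal.span {lin l, q ^ 2} with hI
  let φ := Ideal.Quotient.mkₐ k I
  have hφ : ∀ h, φ h = 0 ↔ h ∈ I := fun h => Ideal.Quotient.eq_zero_iff_mem
  have hae : ∀ h : MvPolynomial (Fin 3) k, aeval (fun j => φ (X j)) h = φ h := by
    intro h
    rw [← comp_aeval_apply, aeval_X_left]
    rfl
  have key := tangentDisc_mul_cofactor hF hq hU (fun j => φ (C (v j))) (fun j => φ (X j))
    (by rw [hae, hφ]; exact Ideal.subset_span (Set.mem_insert _ _))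
    (by
      rw [hae, ← map_pow, hφ]
      exact Ideal.subset_span (Set.mem_insert_of_mem _ rfl))
  rw [tangentDisc_map φ, contactFactor_map φ, hae, hae, ← map_mul, ← map_mul, ← sub_eq_zero,
    ← map_sub, hφ] at key
  obtain ⟨α, β, hαβ⟩ := Ideal.mem_span_pair.1 key
  set E := contactFactor f q U l c (fun j => C (v j)) X with hE
  have hEp : eval p E = contactFactor f q U l c v p := by
    have := contactFactor_map (aeval p : MvPolynomial (Fin 3) k →ₐ[k] k) f q U l c
      (fun j => C (v j)) X
    rw [← aeval_eq_eval]
    change aeval p _ = _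
    rw [hE, ← this]
    congr 1 <;> funext j <;> simp
  refine ⟨E * U + q * (β * U - α * C c), ?_, α, ?_⟩
  · rw [map_add, map_mul, map_mul, hqp, zero_mul, add_zero, hEp]
    exact mul_ne_zero (contactFactor_ne_zero h2 hF hc hq hQ hl hsm hp hlp hqp hpv)
      (cofactor_ne_zero hF hsm hp hlp hqp).1
  · rw [tangentForm]
    linear_combination (-U) * hαβ - α * hF

lemma tangentDisc_smul {f : MvPolynomial (Fin 3) k} (hf : f.IsHomogeneous 4) (v p : Fin 3 → k)
    (t : k) : tangentDisc f v (fun j => t * p j) = t ^ 20 * tangentDisc f v p := by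
  have hg : grad f (fun j => t * p j) ⨯₃ v = fun j => t ^ 3 * (grad f p ⨯₃ v) j := by
    have : grad f (fun j => t * p j) = fun j => t ^ 3 * grad f p j := by
      funext i
      have := eval_smul_homog (hf.pderiv (i := i)) p t
      simpa [grad, aeval_eq_eval] using this
    rw [this]
    funext j
    fin_cases j <;> simp [cross_apply] <;> ring
  rw [tangentDisc, hg, residualDisc_homog hf, tangentDisc]
  ring

lemma dvd_lin_mul_tangentForm_sub {f : MvPolynomial (Fin 3) k} (hf : f.IsHomogeneous 4)
    (v w : Fin 3 → k) :
    f ∣ lin w ^ 6 * tangentForm f v - lin v ^ 6 * tangentForm f w := by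
  let φ := Ideal.Quotient.mkₐ k (Ideal.span {f})
  have hφ : ∀ h, φ h = 0 ↔ f ∣ h := fun h =>
    Ideal.Quotient.eq_zero_iff_mem.trans Ideal.mem_span_singleton
  have hae : aeval (fun j => φ (X j)) f = 0 := by
    rw [← comp_aeval_apply, aeval_X_left]
    exact (hφ f).2 dvd_rfl
  have hl : ∀ u : Fin 3 → k, ∑ j, φ (X j) * φ (C (u j)) = φ (lin u) := by
    intro u
    rw [lin, map_sum]
    exact Finset.sum_congr rfl fun j _ => by rw [map_mul, mul_comm]
  have key := tangentDisc_mul hf (fun j => φ (C (v j))) (fun j => φ (C (w j)))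
    (fun j => φ (X j)) hae
  rw [tangentDisc_map φ, tangentDisc_map φ, hl, hl, ← map_pow, ← map_pow, ← map_mul, ← map_mul,
    ← sub_eq_zero, ← map_sub, hφ] at key
  exact key

/-- Two distinct bitangents do not meet on the curve. -/
lemma parallel_of_common_point [IsAlgClosed k] {f : MvPolynomial (Fin 3) k}
    (hf : f.IsHomogeneous 4)
    (hsm : ∀ p : Fin 3 → k, p ≠ 0 → eval p f = 0 → ∃ i, eval p (pderiv i f) ≠ 0)
    {l l' : Fin 3 → k} (hl : IsBitangentLine f l) (hl' : IsBitangentLine f l')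
    {p : Fin 3 → k} (hp : p ≠ 0) (hfp : eval p f = 0) (hlp : ∑ j, l j * p j = 0)
    (hlp' : ∑ j, l' j * p j = 0) : ∃ t : k, l' = fun j => t * l j := by
  have aux : ∀ {m : Fin 3 → k}, IsBitangentLine f m → ∑ j, m j * p j = 0 →
      ∃ t : k, t ≠ 0 ∧ ∀ j, grad f p j = t * m j := by
    intro m hm hmp
    obtain ⟨q, U, c, hc, -, -, hF, -⟩ := exists_decomposition hf hm
    have hqp : eval p q = 0 := by
      rw [hF] at hfp
      simpa [eval_lin, hmp, hc] using hfp
    exact ⟨_, cofactor_ne_zero hF hsm hp hmp hqp⟩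
  obtain ⟨t, -, h⟩ := aux hl hlp
  obtain ⟨t', ht', h'⟩ := aux hl' hlp'
  refine ⟨t / t', funext fun j => ?_⟩
  have := (h j).symm.trans (h' j)
  field_simp
  linear_combination -this

/-- Local comparison of the square of the tangent discriminant with the product of bitangents. -/
lemma exists_local_comparison [IsAlgClosed k] (h2 : (2 : k) ≠ 0) {f : MvPolynomial (Fin 3) k}
    (hf : f.IsHomogeneous 4)
    (hsm : ∀ p : Fin 3 → k, p ≠ 0 → eval p f = 0 → ∃ i, eval p (pderiv i f) ≠ 0)
    {S : Finset (Fin 3 → k)} (hS : ∀ l ∈ S, IsBitangentLine f l)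
    (hne : ∀ l ∈ S, ∀ l' ∈ S, (∃ t : k, l' = fun j => t * l j) → l' = l) {v : Fin 3 → k}
    (hv : ∀ l ∈ S, ∀ p : Fin 3 → k, ∑ j, l j * p j = 0 → ∑ j, v j * p j = 0 →
      eval p f = 0 → p = 0)
    {p : Fin 3 → k} (hp : p ≠ 0) (hfp : eval p f = 0)
    (hbp : eval p ((∏ l ∈ S, lin l) * lin v ^ 12) = 0) :
    ∃ s s₁, eval p s ≠ 0 ∧
      ((∀ m, IsBitangentLine f m → ∃ l ∈ S, ∃ t : k, t ≠ 0 ∧ m = fun j => t * l j) →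
        eval p s₁ ≠ 0) ∧
      f ∣ s * tangentForm f v ^ 2 - s₁ * ((∏ l ∈ S, lin l) * lin v ^ 12) := by
  classical
  by_cases hvp : ∑ j, v j * p j = 0
  · have hP : ∀ l ∈ S, ∑ j, l j * p j ≠ 0 := fun l hl h0 => hp (hv l hl p h0 hvp hfp)
    obtain ⟨i, hi⟩ := exists_ne_zero_coord hp
    set w : Fin 3 → k := Pi.single i 1 with hw
    have hpw : ∑ j, p j * w j ≠ 0 := by simpa [hw, Pi.single_apply] using hi
    have hwp : eval p (lin w) ≠ 0 := by
      rw [eval_lin]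
      simpa [mul_comm] using hpw
    refine ⟨lin w ^ 12 * ∏ l ∈ S, lin l, tangentForm f w ^ 2, ?_, fun hall => ?_, ?_⟩
    · rw [map_mul, map_pow, map_prod]
      refine mul_ne_zero (pow_ne_zero _ hwp) (Finset.prod_ne_zero_iff.2 fun l hl => ?_)
      rw [eval_lin]
      exact hP l hl
    · rw [map_pow, eval_tangentForm]
      refine pow_ne_zero _ fun h0 => ?_
      obtain ⟨l, hl, t, ht, hm⟩ := hall _ (isBitangentLine_grad h2 hf hsm hp hfp hpw h0)
      apply hP l hl
      have he := euler hf p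
      rw [aeval_eq_eval] at he
      change _ = _ * eval p f at he
      rw [hfp, mul_zero, hm] at he
      have : ∑ j, p j * (t * l j) = t * ∑ j, l j * p j := by
        rw [Finset.mul_sum]
        exact Finset.sum_congr rfl fun j _ => by ring
      rw [this] at he
      exact (mul_eq_zero.1 he).resolve_left ht
    · obtain ⟨r, hr⟩ := dvd_lin_mul_tangentForm_sub hf v w
      refine ⟨r * (lin w ^ 6 * tangentForm f v + lin v ^ 6 * tangentForm f w)
        * ∏ l ∈ S, lin l, ?_⟩
      linear_combination ((lin w ^ 6 * tangentForm f v + lin v ^ 6 * tangentForm f w)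
        * ∏ l ∈ S, lin l) * hr
  · obtain ⟨l, hl, hlp⟩ : ∃ l ∈ S, ∑ j, l j * p j = 0 := by
      rw [map_mul, map_pow, map_prod, eval_lin] at hbp
      have := (mul_eq_zero.1 hbp).resolve_right (pow_ne_zero _ hvp)
      obtain ⟨l, hl, h⟩ := Finset.prod_eq_zero_iff.1 this
      exact ⟨l, hl, by rw [← eval_lin]; exact h⟩
    obtain ⟨q, U, c, hc, hq, hU, hF, hQ⟩ := exists_decomposition hf (hS l hl)
    have hqp : eval p q = 0 := by
      have h := hfp
      rw [hF] at h
      simpa [eval_lin, hlp, hc] using h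
    have hUp := (cofactor_ne_zero hF hsm hp hlp hqp).1
    have hpv : ∑ j, p j * v j ≠ 0 := by simpa [mul_comm] using hvp
    obtain ⟨s, hsp, r, hr⟩ := exists_unit_mul_tangentForm h2 hF hc hq hU hQ (hS l hl).1 hsm hp hlp
      hqp hpv
    have hP' : eval p (∏ l' ∈ S.erase l, lin l') ≠ 0 := by
      rw [map_prod]
      refine Finset.prod_ne_zero_iff.2 fun l' hl' h0 => ?_
      rw [Finset.mem_erase] at hl'
      rw [eval_lin] at h0
      exact hl'.1 (hne l hl l' hl'.2
        (parallel_of_common_point hf hsm (hS l hl) (hS l' hl'.2) hp hfp hlp h0))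
    have hPe : ∏ l ∈ S, lin l = lin l * ∏ l' ∈ S.erase l, lin l' :=
      (Finset.mul_prod_erase S lin hl).symm
    set P' := ∏ l' ∈ S.erase l, lin l' with hP'e
    refine ⟨C c * U ^ 4 * (P' * lin v ^ 12), -(s ^ 2 * U), ?_, fun _ => ?_, ?_⟩
    · simp only [map_mul, map_pow, eval_C]
      refine mul_ne_zero (mul_ne_zero hc (pow_ne_zero _ hUp)) (mul_ne_zero hP' (pow_ne_zero _ ?_))
      rwa [eval_lin]
    · simp only [map_neg, map_mul, map_pow]
      exact neg_ne_zero.2 (mul_ne_zero (pow_ne_zero _ hsp) hUp)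
    · rw [hPe]
      refine ⟨C c * r * (U ^ 2 * tangentForm f v + s * q) * (P' * lin v ^ 12)
        + s ^ 2 * (P' * lin v ^ 12), ?_⟩
      linear_combination (C c * (U ^ 2 * tangentForm f v + s * q) * (P' * lin v ^ 12)) * hr
        - s ^ 2 * (P' * lin v ^ 12) * hF

/-- The tangent discriminant in a general direction does not vanish identically on the curve. -/
lemma exists_tangentForm_ne_zero [IsAlgClosed k] (h2 : (2 : k) ≠ 0) {f : MvPolynomial (Fin 3) k}
    (hf : f.IsHomogeneous 4)
    (hsm : ∀ p : Fin 3 → k, p ≠ 0 → eval p f = 0 → ∃ i, eval p (pderiv i f) ≠ 0)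
    {l : Fin 3 → k} (hl : IsBitangentLine f l) {v : Fin 3 → k}
    (hv : ∀ p : Fin 3 → k, ∑ j, l j * p j = 0 → ∑ j, v j * p j = 0 → eval p f = 0 → p = 0) :
    ∃ p : Fin 3 → k, eval p f = 0 ∧ eval p (tangentForm f v) ≠ 0 := by
  by_contra! hcon
  obtain ⟨q, U, c, hc, hq, hU, hF, hQ⟩ := exists_decomposition hf hl
  obtain ⟨p, hp, hlp, hqp⟩ := exists_zero_mem_line (by norm_num) hq hl.1
  have hfp : eval p f = 0 := by simp [hF, eval_lin, hlp, hqp]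
  have hpv : ∑ j, p j * v j ≠ 0 := fun h0 => hp (hv p hlp (by simpa [mul_comm] using h0) hfp)
  have hUp := (cofactor_ne_zero hF hsm hp hlp hqp).1
  obtain ⟨s, hsp, r, hr⟩ := exists_unit_mul_tangentForm h2 hF hc hq hU hQ hl.1 hsm hp hlp
    hqp hpv
  obtain ⟨N, hN⟩ : ∃ N : ℕ, (s * q) ^ N ∈ Ideal.span {f} := by
    apply mem_radical_of_vanish
    intro z hz
    have hfz : eval z f = 0 := hz f (Ideal.mem_span_singleton_self f)
    have := congrArg (eval z) hr
    rw [map_sub, map_mul, hcon z hfz, map_mul (eval z) f, hfz] at this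
    linear_combination -this
  rw [Ideal.mem_span_singleton] at hN
  obtain ⟨z, hlz, hfz⟩ := exists_ne_zero_on_line hf hsm hl.1
  have hf0 : f ≠ 0 := fun h => hfz (by rw [h, map_zero])
  obtain ⟨π, hπ, hπf, hπp⟩ : ∃ π, Prime π ∧ π ∣ f ∧ eval p π = 0 := by
    obtain ⟨F, hFp, e, he⟩ := UniqueFactorizationMonoid.exists_prime_factors f hf0
    have h0 : (F.map (eval p)).prod = 0 := by
      rw [← map_multiset_prod]
      have := congrArg (eval p) he
      rw [map_mul, hfp] at this
      exact (mul_eq_zero.1 this).resolve_right (e.isUnit.map (eval p)).ne_zero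
    rw [Multiset.prod_eq_zero_iff, Multiset.mem_map] at h0
    obtain ⟨π, hπF, hπp⟩ := h0
    refine ⟨π, hFp π hπF, ?_, hπp⟩
    exact (Multiset.dvd_prod hπF).trans ⟨_, he.symm⟩
  have not_dvd : ∀ h, eval p h ≠ 0 → ¬ π ∣ h := by
    rintro h hh ⟨g, rfl⟩
    simp [hπp] at hh
  have hπq : π ∣ q :=
    (hπ.dvd_or_dvd (hπ.dvd_of_dvd_pow (hπf.trans hN))).resolve_left (not_dvd s hsp)
  have hπl : π ∣ lin l := by
    refine (hπ.dvd_or_dvd (b := U) ?_).resolve_right (not_dvd U hUp)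
    have : lin l * U = f - C c * q ^ 2 := by rw [hF]; ring
    rw [this]
    exact dvd_sub hπf ((dvd_pow hπq two_ne_zero).mul_left _)
  obtain ⟨g, hg⟩ := hπl
  have hl0 := lin_ne_zero hl.1
  have hg0 : g ≠ 0 := by
    rintro rfl
    exact hl0 (by rw [hg, mul_zero])
  have hdeg := totalDegree_mul_of_isDomain hπ.ne_zero hg0
  rw [← hg, (lin_isHomogeneous l).totalDegree hl0] at hdeg
  have hπd : π.totalDegree ≠ 0 := by
    intro h0
    rw [totalDegree_eq_zero_iff_eq_C.1 h0, eval_C] at hπp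
    apply hπ.ne_zero
    rw [totalDegree_eq_zero_iff_eq_C.1 h0, hπp, C_0]
  have hgC := totalDegree_eq_zero_iff_eq_C.1 (show g.totalDegree = 0 by omega)
  have hgc : g.coeff 0 ≠ 0 := by
    intro h0
    exact hg0 (by rw [hgC, h0, C_0])
  have hπz : eval z π = 0 := by
    have := congrArg (eval z) hg
    rw [eval_lin, hlz, map_mul, hgC, eval_C] at this
    exact (mul_eq_zero.1 this.symm).resolve_right hgc
  obtain ⟨g', rfl⟩ := hπf
  exact hfz (by rw [map_mul, hπz, zero_mul])

lemma eval_smul_tangentForm_sq {f : MvPolynomial (Fin 3) k} (hf : f.IsHomogeneous 4)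
    (v p : Fin 3 → k) (t : k) :
    eval (fun j => t * p j) (tangentForm f v ^ 2) = t ^ 40 * eval p (tangentForm f v ^ 2) := by
  rw [map_pow, map_pow, eval_tangentForm, eval_tangentForm, tangentDisc_smul hf]
  ring

lemma prod_lin_mul_isHomogeneous (S : Finset (Fin 3 → k)) (v : Fin 3 → k) :
    ((∏ l ∈ S, lin l) * lin v ^ 12).IsHomogeneous (S.card + 12) := by
  have h1 : (∏ l ∈ S, lin l).IsHomogeneous S.card := by
    simpa using IsHomogeneous.prod S lin (fun _ => 1) fun l _ => lin_isHomogeneous l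
  simpa using h1.mul ((lin_isHomogeneous v).pow 12)

lemma eq_zero_of_mem_generic_line {f : MvPolynomial (Fin 3) k} {S : Finset (Fin 3 → k)}
    {u v p : Fin 3 → k}
    (hS : ∀ l ∈ S, ∀ p : Fin 3 → k, ∑ j, l j * p j = 0 → ∑ j, u j * p j = 0 →
      eval p f = 0 → p = 0)
    (hv : ∀ p : Fin 3 → k, ∑ j, v j * p j = 0 → ∑ j, u j * p j = 0 → eval p f = 0 → p = 0)
    (hup : ∑ j, u j * p j = 0) (hfp : eval p f = 0)
    (hbp : eval p ((∏ l ∈ S, lin l) * lin v ^ 12) = 0) : p = 0 := by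
  rw [map_mul, map_pow, map_prod, mul_eq_zero, pow_eq_zero_iff (by norm_num),
    Finset.prod_eq_zero_iff, eval_lin] at hbp
  rcases hbp with ⟨l, hl, h⟩ | h
  · exact hS l hl p (by rw [← eval_lin]; exact h) hup hfp
  · exact hv p h hup hfp

lemma exists_generic_pair [IsAlgClosed k] {f : MvPolynomial (Fin 3) k}
    (hf : f.IsHomogeneous 4)
    (hsm : ∀ p : Fin 3 → k, p ≠ 0 → eval p f = 0 → ∃ i, eval p (pderiv i f) ≠ 0)
    {S : Finset (Fin 3 → k)} (hS : ∀ l ∈ S, IsBitangentLine f l) :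
    ∃ u v : Fin 3 → k, u ≠ 0 ∧
      (∀ l ∈ S, ∀ p : Fin 3 → k, ∑ j, l j * p j = 0 → ∑ j, v j * p j = 0 →
        eval p f = 0 → p = 0) ∧
      ∀ p : Fin 3 → k, ∑ j, u j * p j = 0 → eval p f = 0 →
        eval p ((∏ l ∈ S, lin l) * lin v ^ 12) = 0 → p = 0 := by
  classical
  have hS' : ∀ l ∈ S, l ≠ 0 ∧ ∃ p : Fin 3 → k, ∑ j, l j * p j = 0 ∧ eval p f ≠ 0 :=
    fun l hl => ⟨(hS l hl).1, exists_ne_zero_on_line hf hsm (hS l hl).1⟩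
  obtain ⟨v, hv0, hv⟩ := exists_generic_line hf S hS'
  obtain ⟨u, hu0, hu⟩ := exists_generic_line hf (insert v S) (by
    intro l hl
    rcases Finset.mem_insert.1 hl with rfl | hl
    · exact ⟨hv0, exists_ne_zero_on_line hf hsm hv0⟩
    · exact hS' l hl)
  exact ⟨u, v, hu0, hv, fun p => eq_zero_of_mem_generic_line
    (fun l hl => hu l (Finset.mem_insert_of_mem hl)) (hu v (Finset.mem_insert_self v S))⟩

/-- A smooth quartic has at most 28 bitangents. -/
lemma card_le [IsAlgClosed k] (h2 : (2 : k) ≠ 0) {f : MvPolynomial (Fin 3) k}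
    (hf : f.IsHomogeneous 4)
    (hsm : ∀ p : Fin 3 → k, p ≠ 0 → eval p f = 0 → ∃ i, eval p (pderiv i f) ≠ 0)
    {S : Finset (Fin 3 → k)} (hS : ∀ l ∈ S, IsBitangentLine f l)
    (hne : ∀ l ∈ S, ∀ l' ∈ S, (∃ t : k, l' = fun j => t * l j) → l' = l) :
    S.card ≤ 28 := by
  obtain rfl | ⟨l, hl⟩ := S.eq_empty_or_nonempty
  · simp
  obtain ⟨u, v, hu, hv, huv⟩ := exists_generic_pair hf hsm hS
  have hmem : tangentForm f v ^ 2 ∈ Ideal.span {f, (∏ l ∈ S, lin l) * lin v ^ 12} := by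
    refine mem_of_local_mem hu huv (exists_ne_zero_on_line hf hsm hu) fun p hp hfp hbp => ?_
    obtain ⟨s, s₁, hs, -, r, hr⟩ := exists_local_comparison h2 hf hsm hS hne hv hp hfp hbp
    exact ⟨s, hs, Ideal.mem_span_pair.2 ⟨r, s₁, by linear_combination -hr⟩⟩
  obtain ⟨p, hfp, hp⟩ := exists_tangentForm_ne_zero h2 hf hsm (hS l hl) (hv l hl)
  have := degree_le_of_mem hf hfp (by rw [map_pow]; exact pow_ne_zero 2 hp)
    (eval_smul_tangentForm_sq hf v p) (eval_smul_homog (prod_lin_mul_isHomogeneous S v) p) hmem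
  omega

/-- A smooth quartic has at least 28 bitangents. -/
lemma le_card [IsAlgClosed k] (h2 : (2 : k) ≠ 0) {f : MvPolynomial (Fin 3) k}
    (hf : f.IsHomogeneous 4)
    (hsm : ∀ p : Fin 3 → k, p ≠ 0 → eval p f = 0 → ∃ i, eval p (pderiv i f) ≠ 0)
    {S : Finset (Fin 3 → k)} (hS : ∀ l ∈ S, IsBitangentLine f l)
    (hne : ∀ l ∈ S, ∀ l' ∈ S, (∃ t : k, l' = fun j => t * l j) → l' = l)
    (hall : ∀ m, IsBitangentLine f m → ∃ l ∈ S, ∃ t : k, t ≠ 0 ∧ m = fun j => t * l j) :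
    28 ≤ S.card := by
  obtain ⟨u, v, hu, hv, huv⟩ := exists_generic_pair hf hsm hS
  have hab : ∀ p : Fin 3 → k, p ≠ 0 → eval p f = 0 → eval p (tangentForm f v ^ 2) = 0 →
      eval p ((∏ l ∈ S, lin l) * lin v ^ 12) = 0 := by
    intro p hp hfp hap
    by_cases hpv : ∑ j, p j * v j = 0
    · have : eval p (lin v) = 0 := by
        rw [eval_lin]
        simpa [mul_comm] using hpv
      simp [this]
    · rw [map_pow, pow_eq_zero_iff two_ne_zero, eval_tangentForm] at hap
      obtain ⟨l, hl, t, ht, hm⟩ := hall _ (isBitangentLine_grad h2 hf hsm hp hfp hpv hap)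
      have he := euler hf p
      rw [aeval_eq_eval] at he
      change _ = _ * eval p f at he
      rw [hfp, mul_zero, hm] at he
      have h' : ∑ j, p j * (t * l j) = t * eval p (lin l) := by
        rw [eval_lin, Finset.mul_sum]
        exact Finset.sum_congr rfl fun j _ => by ring
      rw [h'] at he
      rw [map_mul, map_prod, Finset.prod_eq_zero hl ((mul_eq_zero.1 he).resolve_left ht),
        zero_mul]
  have hua : ∀ p : Fin 3 → k, ∑ j, u j * p j = 0 → eval p f = 0 →
      eval p (tangentForm f v ^ 2) = 0 → p = 0 := by
    intro p hup hfp hap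
    by_contra hp
    exact hp (huv p hup hfp (hab p hp hfp hap))
  have hmem : (∏ l ∈ S, lin l) * lin v ^ 12 ∈ Ideal.span {f, tangentForm f v ^ 2} := by
    refine mem_of_local_mem hu hua (exists_ne_zero_on_line hf hsm hu) fun p hp hfp hap => ?_
    obtain ⟨s, s₁, -, hs, r, hr⟩ :=
      exists_local_comparison h2 hf hsm hS hne hv hp hfp (hab p hp hfp hap)
    exact ⟨s₁, hs hall, Ideal.mem_span_pair.2 ⟨-r, s, by linear_combination hr⟩⟩
  obtain ⟨p, hp, hup, hfp⟩ := exists_zero_mem_line (by norm_num) hf hu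
  have := degree_le_of_mem hf hfp (fun h => hp (huv p hup hfp h))
    (eval_smul_homog (prod_lin_mul_isHomogeneous S v) p) (eval_smul_tangentForm_sq hf v p) hmem
  omega

lemma isBitangentLine_smul {f : MvPolynomial (Fin 3) k} {l : Fin 3 → k}
    (hl : IsBitangentLine f l) {t : k} (ht : t ≠ 0) : IsBitangentLine f (t • l) := by
  obtain ⟨hl0, q, c, hc, hq, ⟨p, hp, hqp⟩, hfq⟩ := hl
  have h : ∀ p : Fin 3 → k, ∑ j, (t • l) j * p j = t * ∑ j, l j * p j := by
    intro p
    rw [Finset.mul_sum]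
    exact Finset.sum_congr rfl fun j _ => by simp [mul_assoc]
  refine ⟨smul_ne_zero ht hl0, q, c, hc, hq, ⟨p, ?_, hqp⟩, fun p hp => hfq p ?_⟩
  · rw [h, hp, mul_zero]
  · rw [h] at hp
    exact (mul_eq_zero.1 hp).resolve_left ht

lemma eq_of_rep_eq_mul {L L' : Projectivization k (Fin 3 → k)} {t : k}
    (h : L'.rep = fun j => t * L.rep j) : L' = L := by
  rw [← L.mk_rep, ← L'.mk_rep, Projectivization.mk_eq_mk_iff']
  exact ⟨t, h.symm⟩

end Field

end PlaneQuartic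

/-- Over an algebraically closed field of characteristic ≠ 2, a
smooth plane quartic has exactly 28 bitangent lines. -/
theorem statement13 {k : Type*} [Field k] [IsAlgClosed k] (hchar : (2 : k) ≠ 0)
    (f : MvPolynomial (Fin 3) k) (hf : f.IsHomogeneous 4)
    (hsm : ∀ p : Fin 3 → k, p ≠ 0 → eval p f = 0 → ∃ i, eval p (pderiv i f) ≠ 0) :
    {L : Projectivization k (Fin 3 → k) | IsBitangentLine f L.rep}.ncard = 28 := by
  classical
  have hinj : Function.Injective (Projectivization.rep : Projectivization k (Fin 3 → k) → _) :=
    fun L L' h => PlaneQuartic.eq_of_rep_eq_mul (t := 1) (by rw [h]; simp)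
  have hS : ∀ T : Finset (Projectivization k (Fin 3 → k)), (∀ L ∈ T, IsBitangentLine f L.rep) →
      ∀ l ∈ T.image Projectivization.rep, IsBitangentLine f l := by
    intro T hT l hl
    obtain ⟨L, hL, rfl⟩ := Finset.mem_image.1 hl
    exact hT L hL
  have hne : ∀ T : Finset (Projectivization k (Fin 3 → k)),
      ∀ l ∈ T.image Projectivization.rep, ∀ l' ∈ T.image Projectivization.rep,
      (∃ t : k, l' = fun j => t * l j) → l' = l := by
    intro T l hl l' hl' ⟨t, ht⟩
    obtain ⟨L, hL, rfl⟩ := Finset.mem_image.1 hl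
    obtain ⟨L', hL', rfl⟩ := Finset.mem_image.1 hl'
    rw [PlaneQuartic.eq_of_rep_eq_mul ht]
  have hle : ∀ T : Finset (Projectivization k (Fin 3 → k)),
      (∀ L ∈ T, IsBitangentLine f L.rep) → T.card ≤ 28 := by
    intro T hT
    rw [← Finset.card_image_of_injective T hinj]
    exact PlaneQuartic.card_le hchar hf hsm (hS T hT) (hne T)
  have hfin : {L : Projectivization k (Fin 3 → k) | IsBitangentLine f L.rep}.Finite := by
    by_contra hinf
    obtain ⟨T, hT, hcard⟩ := Set.Infinite.exists_subset_card_eq hinf 29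
    have := hle T fun L hL => hT hL
    omega
  rw [Set.ncard_eq_toFinset_card _ hfin]
  have hT : ∀ L ∈ hfin.toFinset, IsBitangentLine f L.rep := fun L hL => by simpa using hL
  refine le_antisymm (hle _ hT) ?_
  rw [← Finset.card_image_of_injective _ hinj]
  refine PlaneQuartic.le_card hchar hf hsm (hS _ hT) (hne _) fun m hm => ?_
  obtain ⟨a, ha⟩ := Projectivization.exists_smul_eq_mk_rep k m hm.1
  refine ⟨(Projectivization.mk k m hm.1).rep, Finset.mem_image_of_mem _ ?_, (a : k)⁻¹,
    inv_ne_zero a.ne_zero, ?_⟩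
  · rw [Set.Finite.mem_toFinset, Set.mem_ofPred_eq, ← ha]
    exact PlaneQuartic.isBitangentLine_smul hm a.ne_zero
  · rw [← ha]
    funext j
    simp [Units.smul_def]
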